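/- arXiv:2503.09845 — 2 statements merged into one kernel-verified Lean document; each statement's English description precedes it below -/
import Mathlib

section
/- Let K be a field and q ∈ K invertible such that κ := q⁸+q⁻⁸+q⁶+q⁻⁶−q²−1−q⁻² is nonzero, and let the 3×3 matrix f_{ω1}(z) over K be defined as in the context (this is the matrix governing the L_{ω1}-isotypic block of the E₈ trigonometric R-matrix). Then for every invertible z ∈ K: f_{ω1}(z) · f_{ω1}(z⁻¹) = q³⁴ (1−q⁻²z)(1−q⁻¹²z)(1−q⁻²⁰z)(1−q⁻²z⁻¹)(1−q⁻¹²z⁻¹)(1−q⁻²⁰z⁻¹) · Id₃, and moreover f_{ω1}(1) = (q−q⁻¹)(q⁶−q⁻⁶)(q¹⁰−q⁻¹⁰) · Id₃. -/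
open Matrix

variable {K : Type*} [Field K]

/-- `κ = q⁸+q⁻⁸+q⁶+q⁻⁶−q²−1−q⁻²` (the symmetric form of the 60th cyclotomic polynomial). -/
noncomputable def kapE8 (q : K) : K :=
  q ^ (8 : ℤ) + q ^ (-8 : ℤ) + q ^ (6 : ℤ) + q ^ (-6 : ℤ) - q ^ (2 : ℤ) - 1 - q ^ (-2 : ℤ)

noncomputable def alphaE8 (q : K) : K :=
  ((q ^ (19 : ℤ) - q ^ (-19 : ℤ)) - (q ^ (17 : ℤ) + q ^ (-17 : ℤ))
      - (q ^ (13 : ℤ) - q ^ (-13 : ℤ)) - 2 * q ^ (15 : ℤ)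
      + q ^ (11 : ℤ) + q ^ (9 : ℤ) - q⁻¹) / kapE8 q

noncomputable def betaE8 (q : K) : K :=
  (q ^ (2 : ℤ) - q ^ (-2 : ℤ)) * (q ^ (3 : ℤ) - q ^ (-3 : ℤ)) / kapE8 q

noncomputable def gammaE8 (q : K) : K :=
  (q ^ (2 : ℤ) - q ^ (-2 : ℤ)) * (q ^ (5 : ℤ) - q ^ (-5 : ℤ)) * (q ^ (16 : ℤ) + q ^ (-16 : ℤ))
    * (q ^ (6 : ℤ) - 1 + q ^ (-6 : ℤ))
    * (∑ k ∈ Finset.range 15, q ^ (14 - 2 * (k : ℤ))) / kapE8 q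

noncomputable def aE8 (q : K) : K :=
  (q ^ (2 : ℤ) - q ^ (-2 : ℤ)) * (q ^ (3 : ℤ) - q ^ (-3 : ℤ)) * (q ^ (5 : ℤ) - q ^ (-5 : ℤ)) / kapE8 q

noncomputable def bE8 (q : K) : K :=
  ((q + q⁻¹) * (q ^ (12 : ℤ) + q ^ (-12 : ℤ)) - (q ^ (7 : ℤ) + q ^ (-7 : ℤ))) / kapE8 q

/-- The 3×3 matrix `f_{ω1}(z)` governing the `L_{ω1}`-isotypic block of the E₈
trigonometric R-matrix. -/
noncomputable def fom1E8 (q z : K) : Matrix (Fin 3) (Fin 3) K :=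
  !![-q ^ (-15 : ℤ) - q ^ (-6 : ℤ) * alphaE8 q⁻¹ * z + q ^ (6 : ℤ) * alphaE8 q * z ^ 2
        + q ^ (15 : ℤ) * z ^ 3,
      betaE8 q * z * (1 - z), betaE8 q * z * (1 - z);
    gammaE8 q * z * (1 - z), aE8 q * z * (q ^ (15 : ℤ) + q ^ (-15 : ℤ) * z),
      (1 - z) * (q ^ (15 : ℤ) - bE8 q * z + q ^ (-15 : ℤ) * z ^ 2);
    gammaE8 q * z * (1 - z), (1 - z) * (q ^ (15 : ℤ) - bE8 q * z + q ^ (-15 : ℤ) * z ^ 2),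
      aE8 q * z * (q ^ (15 : ℤ) + q ^ (-15 : ℤ) * z)]


/-- The polynomial `q⁸ κ`. -/
def kkE8 (q : K) : K := q ^ 16 + q ^ 14 - q ^ 10 - q ^ 8 - q ^ 6 + q ^ 2 + 1

theorem kapE8_eq (q : K) (hq : q ≠ 0) : kapE8 q = kkE8 q / q ^ 8 := by
  unfold kapE8 kkE8
  simp only [_root_.zpow_neg, zpow_ofNat]
  field_simp
  ring

theorem kapE8_inv (q : K) : kapE8 q⁻¹ = kapE8 q := by
  unfold kapE8
  simp only [_root_.zpow_neg, zpow_ofNat, inv_pow, inv_inv]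
  ring

/-- Numerator of `α_q`. -/
def nAlpha (q : K) : K :=
  q ^ 38 - 1 - q ^ 36 - q ^ 2 - q ^ 32 + q ^ 6 - 2 * q ^ 34 + q ^ 30 + q ^ 28 - q ^ 18

/-- Numerator of `α_{q⁻¹}`. -/
def nAlphaInv (q : K) : K :=
  1 - q ^ 38 - q ^ 36 - q ^ 2 - q ^ 6 + q ^ 32 - 2 * q ^ 4 + q ^ 8 + q ^ 10 - q ^ 20

/-- Numerator of `β_q`. -/
def nBeta (q : K) : K := (q ^ 4 - 1) * (q ^ 6 - 1)

/-- Numerator of `γ_q`. -/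
def nGamma (q : K) : K :=
  (q ^ 4 - 1) * (q ^ 10 - 1) * (q ^ 32 + 1) * (q ^ 12 - q ^ 6 + 1)
    * (1 + q ^ 2 + q ^ 4 + q ^ 6 + q ^ 8 + q ^ 10 + q ^ 12 + q ^ 14 + q ^ 16 + q ^ 18 + q ^ 20
      + q ^ 22 + q ^ 24 + q ^ 26 + q ^ 28)

/-- Numerator of `a_q`. -/
def nA (q : K) : K := (q ^ 4 - 1) * (q ^ 6 - 1) * (q ^ 10 - 1)

/-- Numerator of `b_q`. -/
def nB (q : K) : K := (q ^ 2 + 1) * (q ^ 24 + 1) - q ^ 20 - q ^ 6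

theorem alphaE8_eq (q : K) (hq : q ≠ 0) (hk : kkE8 q ≠ 0) :
    alphaE8 q = nAlpha q / (q ^ 11 * kkE8 q) := by
  unfold alphaE8 nAlpha
  rw [kapE8_eq q hq]
  simp only [_root_.zpow_neg, zpow_ofNat]
  field_simp
  ring

theorem alphaE8_inv_eq (q : K) (hq : q ≠ 0) (hk : kkE8 q ≠ 0) :
    alphaE8 q⁻¹ = nAlphaInv q / (q ^ 11 * kkE8 q) := by
  unfold alphaE8 nAlphaInv
  rw [kapE8_inv, kapE8_eq q hq]
  simp only [_root_.zpow_neg, zpow_ofNat, inv_pow, inv_inv]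
  field_simp
  ring

theorem betaE8_eq (q : K) (hq : q ≠ 0) (hk : kkE8 q ≠ 0) :
    betaE8 q = q ^ 3 * nBeta q / kkE8 q := by
  unfold betaE8 nBeta
  rw [kapE8_eq q hq]
  simp only [_root_.zpow_neg, zpow_ofNat]
  field_simp

theorem sumE8_eq (q : K) (hq : q ≠ 0) :
    (∑ k ∈ Finset.range 15, q ^ (14 - 2 * (k : ℤ))) =
      (1 + q ^ 2 + q ^ 4 + q ^ 6 + q ^ 8 + q ^ 10 + q ^ 12 + q ^ 14 + q ^ 16 + q ^ 18 + q ^ 20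
      + q ^ 22 + q ^ 24 + q ^ 26 + q ^ 28) / q ^ 14 := by
  simp only [Finset.sum_range_succ, Finset.sum_range_zero]
  norm_num [_root_.zpow_neg, zpow_ofNat]
  field_simp
  ring

theorem gammaE8_eq (q : K) (hq : q ≠ 0) (hk : kkE8 q ≠ 0) :
    gammaE8 q = nGamma q / (q ^ 35 * kkE8 q) := by
  unfold gammaE8 nGamma
  rw [kapE8_eq q hq, sumE8_eq q hq]
  simp only [_root_.zpow_neg, zpow_ofNat]
  generalize (1 + q ^ 2 + q ^ 4 + q ^ 6 + q ^ 8 + q ^ 10 + q ^ 12 + q ^ 14 + q ^ 16 + q ^ 18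
      + q ^ 20 + q ^ 22 + q ^ 24 + q ^ 26 + q ^ 28) = S
  field_simp
  try ring

theorem aE8_eq (q : K) (hq : q ≠ 0) (hk : kkE8 q ≠ 0) :
    aE8 q = nA q / (q ^ 2 * kkE8 q) := by
  unfold aE8 nA
  rw [kapE8_eq q hq]
  simp only [_root_.zpow_neg, zpow_ofNat]
  field_simp

theorem bE8_eq (q : K) (hq : q ≠ 0) (hk : kkE8 q ≠ 0) :
    bE8 q = nB q / (q ^ 5 * kkE8 q) := by
  unfold bE8 nB
  rw [kapE8_eq q hq]
  simp only [_root_.zpow_neg, zpow_ofNat]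
  field_simp
  ring

set_option maxHeartbeats 4000000 in
/-- Unitarity and normalization of the `L_{ω1}`-block of the E₈ trigonometric R-matrix. -/
theorem E8_om1_block (q : K) (hq : q ≠ 0) (hkap : kapE8 q ≠ 0) :
    (∀ z : K, z ≠ 0 →
      fom1E8 q z * fom1E8 q z⁻¹ =
        (q ^ (34 : ℤ) * (1 - q ^ (-2 : ℤ) * z) * (1 - q ^ (-12 : ℤ) * z) * (1 - q ^ (-20 : ℤ) * z)
            * (1 - q ^ (-2 : ℤ) * z⁻¹) * (1 - q ^ (-12 : ℤ) * z⁻¹) * (1 - q ^ (-20 : ℤ) * z⁻¹)) •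
          (1 : Matrix (Fin 3) (Fin 3) K))
    ∧ fom1E8 q 1 =
        ((q - q⁻¹) * (q ^ (6 : ℤ) - q ^ (-6 : ℤ)) * (q ^ (10 : ℤ) - q ^ (-10 : ℤ))) •
          (1 : Matrix (Fin 3) (Fin 3) K) := by
  have hk : kkE8 q ≠ 0 := by
    intro h
    apply hkap
    rw [kapE8_eq q hq, h, zero_div]
  refine ⟨?_, ?_⟩
  · intro z hz
    unfold fom1E8
    rw [alphaE8_eq q hq hk, alphaE8_inv_eq q hq hk, betaE8_eq q hq hk, gammaE8_eq q hq hk,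
      aE8_eq q hq hk, bE8_eq q hq hk]
    simp only [_root_.zpow_neg, zpow_ofNat]
    ext i j
    fin_cases i <;> fin_cases j <;>
      simp [Matrix.mul_apply, Fin.sum_univ_three] <;> field_simp <;>
      simp only [nAlpha, nAlphaInv, nBeta, nGamma, nA, nB, kkE8] <;> ring
  · unfold fom1E8
    rw [alphaE8_eq q hq hk, alphaE8_inv_eq q hq hk, betaE8_eq q hq hk, gammaE8_eq q hq hk,
      aE8_eq q hq hk, bE8_eq q hq hk]
    simp only [_root_.zpow_neg, zpow_ofNat]
    ext i j
    fin_cases i <;> fin_cases j <;>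
      simp <;> field_simp <;>
      simp only [nAlpha, nAlphaInv, nBeta, nGamma, nA, nB, kkE8] <;> ring
end

section
/- Let K be a field and q ∈ K invertible such that κ := q⁸+q⁻⁸+q⁶+q⁻⁶−q²−1−q⁻² is nonzero, and let the 2×2 matrix f_{ω0}(z) over K be defined as in the context (this is the matrix governing the L_{ω0}-isotypic block of the E₈ trigonometric R-matrix). Then for every invertible z ∈ K: f_{ω0}(z) · f_{ω0}(z⁻¹) = q⁶⁴ (1−q⁻²z)(1−q⁻¹²z)(1−q⁻²⁰z)(1−q⁻³⁰z)(1−q⁻²z⁻¹)(1−q⁻¹²z⁻¹)(1−q⁻²⁰z⁻¹)(1−q⁻³⁰z⁻¹) · Id₂, and moreover f_{ω0}(1) = (q−q⁻¹)(q⁶−q⁻⁶)(q¹⁰−q⁻¹⁰)(q¹⁵−q⁻¹⁵) · Id₂. -/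
open Matrix

variable {K : Type*} [Field K]

noncomputable def zetaE8 (q : K) : K :=
  (q + q⁻¹) * (q ^ (16 : ℤ) + q ^ (-16 : ℤ)) * (q ^ (6 : ℤ) - 1 + q ^ (-6 : ℤ)) / kapE8 q

noncomputable def xiE8 (q : K) : K :=
  (q ^ (32 : ℤ) + q ^ (-32 : ℤ)) - (q ^ (30 : ℤ) + q ^ (-30 : ℤ))
    + (q ^ (18 : ℤ) + q ^ (-18 : ℤ)) + (q ^ (10 : ℤ) + q ^ (-10 : ℤ)) + 2

noncomputable def etaE8 (q : K) : K :=
  (q ^ (2 : ℤ) - q ^ (-2 : ℤ)) * (q ^ (3 : ℤ) - q ^ (-3 : ℤ)) * (q ^ (5 : ℤ) - q ^ (-5 : ℤ)) / kapE8 q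

noncomputable def rhoE8 (q : K) : K :=
  (q ^ (2 : ℤ) - q ^ (-2 : ℤ)) * (q ^ (3 : ℤ) - q ^ (-3 : ℤ)) * (q ^ (5 : ℤ) - q ^ (-5 : ℤ))
    * (q ^ (6 : ℤ) + q ^ (-6 : ℤ)) * (q ^ (10 : ℤ) + q ^ (-10 : ℤ)) * (q ^ (12 : ℤ) + q ^ (-12 : ℤ))
    * (∑ k ∈ Finset.range 31, q ^ (30 - 2 * (k : ℤ))) / kapE8 q

/-- The 2×2 matrix `f_{ω0}(z)` governing the `L_{ω0}`-isotypic block of the E₈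
trigonometric R-matrix. -/
noncomputable def fom0E8 (q z : K) : Matrix (Fin 2) (Fin 2) K :=
  !![q ^ (-30 : ℤ) - q ^ (-15 : ℤ) * zetaE8 q * z + xiE8 q * z ^ 2
        - q ^ (15 : ℤ) * zetaE8 q * z ^ 3 + q ^ (30 : ℤ) * z ^ 4,
      etaE8 q * z * (1 - z ^ 2);
    rhoE8 q * z * (1 - z ^ 2),
      q ^ (30 : ℤ) - q ^ (15 : ℤ) * zetaE8 q * z + xiE8 q * z ^ 2
        - q ^ (-15 : ℤ) * zetaE8 q * z ^ 3 + q ^ (-30 : ℤ) * z ^ 4]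

/-- The Laurent polynomial `κ` with the denominator cleared. -/
lemma kapE8_mul (q : K) (hq : q ≠ 0) :
    kapE8 q = (q ^ 16 + q ^ 14 - q ^ 10 - q ^ 8 - q ^ 6 + q ^ 2 + 1) / q ^ 8 := by
  unfold kapE8
  simp only [_root_.zpow_neg, zpow_ofNat]
  field_simp
  ring

lemma sumE8 (q : K) (hq : q ≠ 0) :
    ∑ k ∈ Finset.range 31, q ^ (30 - 2 * (k : ℤ)) =
      (∑ k ∈ Finset.range 31, q ^ (2 * k)) / q ^ 30 := by
  rw [← Finset.sum_range_reflect, Finset.sum_div]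
  refine Finset.sum_congr rfl fun k hk => ?_
  have hk' : k ≤ 30 := by have := Finset.mem_range.mp hk; omega
  rw [eq_div_iff (pow_ne_zero _ hq), ← zpow_natCast, ← zpow_natCast, ← zpow_add₀ hq]
  congr 1
  push_cast [Nat.cast_sub hk']
  omega

/-- Coefficient of `z³`. -/
lemma coeff3E8 (q : K) (hq : q ≠ 0) (hkap : kapE8 q ≠ 0) :
    zetaE8 q * (q ^ 30 + 1) * q ^ 17 = q ^ 62 + q ^ 52 + q ^ 44 + q ^ 34 + q ^ 30 + q ^ 20 + q ^ 12 + q ^ 2 := by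
  have h := kapE8_mul q hq
  unfold zetaE8
  rw [div_mul_eq_mul_div, div_mul_eq_mul_div, div_eq_iff hkap, h]
  simp only [_root_.zpow_neg, zpow_ofNat]
  field_simp
  ring

/-- The combination `ζ² - ηρ` entering the coefficient of `z²`. -/
lemma coeff2E8 (q : K) (hq : q ≠ 0) (hkap : kapE8 q ≠ 0) :
    (zetaE8 q ^ 2 - etaE8 q * rhoE8 q) * q ^ 62 =
      -q ^ 124 + q ^ 122 + q ^ 112 - q ^ 110 + q ^ 104 - q ^ 102
      + 2 * q ^ 94 - 2 * q ^ 92 + q ^ 90 + q ^ 84 - q ^ 82 + 2 * q ^ 80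
      + q ^ 76 - q ^ 74 + 2 * q ^ 72 + q ^ 70 - q ^ 64 + 6 * q ^ 62 - q ^ 60 + q ^ 54
      + 2 * q ^ 52 - q ^ 50 + q ^ 48 + 2 * q ^ 44 - q ^ 42 + q ^ 40
      + q ^ 34 - 2 * q ^ 32 + 2 * q ^ 30 - q ^ 22 + q ^ 20 - q ^ 14 + q ^ 12 + q ^ 2 - 1 := by
  have h := kapE8_mul q hq
  obtain ⟨P, hPdef⟩ : ∃ P : K, P = q ^ 16 + q ^ 14 - q ^ 10 - q ^ 8 - q ^ 6 + q ^ 2 + 1 := ⟨_, rfl⟩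
  rw [← hPdef] at h
  have hP : P ≠ 0 := by
    intro h0; rw [h0, zero_div] at h; exact hkap h
  unfold zetaE8 etaE8 rhoE8
  rw [sumE8 q hq, h]
  simp only [_root_.zpow_neg, zpow_ofNat, Finset.sum_range_succ, Finset.sum_range_zero]
  field_simp
  rw [hPdef]
  ring

/-- The combination entering the coefficient of `z⁰`. -/
lemma coeff0E8 (q : K) (hq : q ≠ 0) (hkap : kapE8 q ≠ 0) :
    zetaE8 q ^ 2 * (q ^ 94 + q ^ 34) + 2 * (etaE8 q * rhoE8 q) * q ^ 64 =
      2 * q ^ 126 - q ^ 124 + 2 * q ^ 112 + 3 * q ^ 104 + 4 * q ^ 94 + q ^ 88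
      + 2 * q ^ 84 + 2 * q ^ 76 + q ^ 68 + 2 * q ^ 66 - 4 * q ^ 64 + 2 * q ^ 62 + q ^ 60
      + 2 * q ^ 52 + 2 * q ^ 44 + q ^ 40 + 4 * q ^ 34 + 3 * q ^ 24 + 2 * q ^ 16 - q ^ 4
      + 2 * q ^ 2 := by
  have h := kapE8_mul q hq
  obtain ⟨P, hPdef⟩ : ∃ P : K, P = q ^ 16 + q ^ 14 - q ^ 10 - q ^ 8 - q ^ 6 + q ^ 2 + 1 := ⟨_, rfl⟩
  rw [← hPdef] at h
  have hP : P ≠ 0 := by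
    intro h0; rw [h0, zero_div] at h; exact hkap h
  unfold zetaE8 etaE8 rhoE8
  rw [sumE8 q hq, h]
  simp only [_root_.zpow_neg, zpow_ofNat, Finset.sum_range_succ, Finset.sum_range_zero]
  field_simp
  rw [hPdef]
  ring

/-- `q³² ξ` as a polynomial. -/
noncomputable def xE8P (q : K) : K :=
  q ^ 64 - q ^ 62 + q ^ 50 + q ^ 42 + 2 * q ^ 32 + q ^ 22 + q ^ 14 - q ^ 2 + 1

lemma xiE8_eq (q : K) (hq : q ≠ 0) : xiE8 q = xE8P q / q ^ 32 := by
  unfold xiE8 xE8P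
  simp only [_root_.zpow_neg, zpow_ofNat]
  field_simp
  ring

/-- The diagonal entry of the unitarity relation with denominators cleared. -/
lemma clearedE8 (q : K) (hq : q ≠ 0) (hkap : kapE8 q ≠ 0) (z : K) :
    (q ^ 2 - q ^ 17 * zetaE8 q * z + xE8P q * z ^ 2 - q ^ 47 * zetaE8 q * z ^ 3 + q ^ 62 * z ^ 4)
      * (q ^ 2 * z ^ 4 - q ^ 17 * zetaE8 q * z ^ 3 + xE8P q * z ^ 2 - q ^ 47 * zetaE8 q * z + q ^ 62)
      - etaE8 q * rhoE8 q * q ^ 64 * z ^ 2 * (1 - z ^ 2) ^ 2 =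
    (q ^ 2 - z) * (q ^ 12 - z) * (q ^ 20 - z) * (q ^ 30 - z)
      * (q ^ 2 * z - 1) * (q ^ 12 * z - 1) * (q ^ 20 * z - 1) * (q ^ 30 * z - 1) := by
  have h3 := coeff3E8 q hq hkap
  have h2 := coeff2E8 q hq hkap
  have h0 := coeff0E8 q hq hkap
  unfold xE8P
  linear_combination (-q ^ 32 * (z ^ 7 + z)
    - (q ^ 64 - q ^ 62 + q ^ 50 + q ^ 42 + 2 * q ^ 32 + q ^ 22 + q ^ 14 - q ^ 2 + 1
      + q ^ 62 - q ^ 32 + q ^ 2) * (z ^ 5 + z ^ 3)) * h3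
    + q ^ 2 * (z ^ 6 + z ^ 2) * h2 + z ^ 4 * h0

lemma entryE8 (q : K) (hq : q ≠ 0) (z : K) :
    fom0E8 q z 0 0 = (q ^ 2 - q ^ 17 * zetaE8 q * z + xE8P q * z ^ 2 - q ^ 47 * zetaE8 q * z ^ 3
      + q ^ 62 * z ^ 4) / q ^ 32 := by
  simp only [fom0E8, Matrix.of_apply, Matrix.cons_val', Matrix.cons_val_zero,
    Matrix.cons_val_fin_one, xiE8_eq q hq, _root_.zpow_neg, zpow_ofNat]
  field_simp

lemma entryE8' (q : K) (hq : q ≠ 0) (z : K) :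
    fom0E8 q z 1 1 = (q ^ 2 * z ^ 4 - q ^ 17 * zetaE8 q * z ^ 3 + xE8P q * z ^ 2
      - q ^ 47 * zetaE8 q * z + q ^ 62) / q ^ 32 := by
  simp only [fom0E8, Matrix.of_apply, Matrix.cons_val', Matrix.cons_val_one,
    Matrix.cons_val_fin_one, xiE8_eq q hq, _root_.zpow_neg, zpow_ofNat]
  field_simp
  ring

/-- Unitarity and normalization of the `L_{ω0}`-block of the E₈ trigonometric R-matrix. -/
theorem E8_om0_block (q : K) (hq : q ≠ 0) (hkap : kapE8 q ≠ 0) :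
    (∀ z : K, z ≠ 0 →
      fom0E8 q z * fom0E8 q z⁻¹ =
        (q ^ (64 : ℤ) * (1 - q ^ (-2 : ℤ) * z) * (1 - q ^ (-12 : ℤ) * z) * (1 - q ^ (-20 : ℤ) * z)
            * (1 - q ^ (-30 : ℤ) * z)
            * (1 - q ^ (-2 : ℤ) * z⁻¹) * (1 - q ^ (-12 : ℤ) * z⁻¹) * (1 - q ^ (-20 : ℤ) * z⁻¹)
            * (1 - q ^ (-30 : ℤ) * z⁻¹)) •
          (1 : Matrix (Fin 2) (Fin 2) K))
    ∧ fom0E8 q 1 =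
        ((q - q⁻¹) * (q ^ (6 : ℤ) - q ^ (-6 : ℤ)) * (q ^ (10 : ℤ) - q ^ (-10 : ℤ))
            * (q ^ (15 : ℤ) - q ^ (-15 : ℤ))) •
          (1 : Matrix (Fin 2) (Fin 2) K) := by
  have e01 : ∀ z : K, fom0E8 q z 0 1 = etaE8 q * z * (1 - z ^ 2) := fun z => by simp [fom0E8]
  have e10 : ∀ z : K, fom0E8 q z 1 0 = rhoE8 q * z * (1 - z ^ 2) := fun z => by simp [fom0E8]
  have e00 := entryE8 q hq
  have e11 := entryE8' q hq
  constructor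
  · intro z hz
    have hc := clearedE8 q hq hkap z
    have h0011 : fom0E8 q z⁻¹ 0 0 = fom0E8 q z 1 1 / z ^ 4 := by
      rw [e00, e11]; field_simp
    have h1100 : fom0E8 q z⁻¹ 1 1 = fom0E8 q z 0 0 / z ^ 4 := by
      rw [e00, e11]; field_simp
    have hd : fom0E8 q z 0 0 * fom0E8 q z 1 1 / z ^ 4
        + etaE8 q * z * (1 - z ^ 2) * (rhoE8 q * z⁻¹ * (1 - z⁻¹ ^ 2)) =
        q ^ (64 : ℤ) * (1 - q ^ (-2 : ℤ) * z) * (1 - q ^ (-12 : ℤ) * z) * (1 - q ^ (-20 : ℤ) * z)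
            * (1 - q ^ (-30 : ℤ) * z)
            * (1 - q ^ (-2 : ℤ) * z⁻¹) * (1 - q ^ (-12 : ℤ) * z⁻¹) * (1 - q ^ (-20 : ℤ) * z⁻¹)
            * (1 - q ^ (-30 : ℤ) * z⁻¹) := by
      have hr : q ^ (64 : ℤ) * (1 - q ^ (-2 : ℤ) * z) * (1 - q ^ (-12 : ℤ) * z)
            * (1 - q ^ (-20 : ℤ) * z) * (1 - q ^ (-30 : ℤ) * z)
            * (1 - q ^ (-2 : ℤ) * z⁻¹) * (1 - q ^ (-12 : ℤ) * z⁻¹) * (1 - q ^ (-20 : ℤ) * z⁻¹)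
            * (1 - q ^ (-30 : ℤ) * z⁻¹) =
          ((q ^ 2 - z) * (q ^ 12 - z) * (q ^ 20 - z) * (q ^ 30 - z)
      * (q ^ 2 * z - 1) * (q ^ 12 * z - 1) * (q ^ 20 * z - 1) * (q ^ 30 * z - 1))
            / (q ^ 64 * z ^ 4) := by
        simp only [_root_.zpow_neg, zpow_ofNat]
        field_simp
      rw [hr, ← hc, e00, e11]
      generalize zetaE8 q = t
      generalize xE8P q = x
      field_simp
      ring
    ext i j
    fin_cases i <;> fin_cases j
    · simp only [Fin.zero_eta, Fin.mk_one, Fin.isValue, Matrix.mul_apply, Fin.sum_univ_two,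
        Matrix.smul_apply, Matrix.one_apply_eq, smul_eq_mul, mul_one]
      rw [← hd, h0011, e01, e10]; ring
    · simp only [Fin.zero_eta, Fin.mk_one, Fin.isValue, Matrix.mul_apply, Fin.sum_univ_two,
        Matrix.smul_apply, smul_eq_mul]
      rw [h1100, e01, e01, Matrix.one_apply_ne (by decide), mul_zero]
      field_simp; ring
    · simp only [Fin.zero_eta, Fin.mk_one, Fin.isValue, Matrix.mul_apply, Fin.sum_univ_two,
        Matrix.smul_apply, smul_eq_mul]
      rw [h0011, e10, e10, Matrix.one_apply_ne (by decide), mul_zero]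
      field_simp; ring
    · simp only [Fin.zero_eta, Fin.mk_one, Fin.isValue, Matrix.mul_apply, Fin.sum_univ_two,
        Matrix.smul_apply, Matrix.one_apply_eq, smul_eq_mul, mul_one]
      rw [← hd, h1100, e01, e10]; field_simp; ring
  · have h3 := coeff3E8 q hq hkap
    have hn : (q ^ 2 - q ^ 17 * zetaE8 q + xE8P q - q ^ 47 * zetaE8 q + q ^ 62) / q ^ 32 =
        (q - q⁻¹) * (q ^ (6 : ℤ) - q ^ (-6 : ℤ)) * (q ^ (10 : ℤ) - q ^ (-10 : ℤ))
            * (q ^ (15 : ℤ) - q ^ (-15 : ℤ)) := by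
      have hr : (q - q⁻¹) * (q ^ (6 : ℤ) - q ^ (-6 : ℤ)) * (q ^ (10 : ℤ) - q ^ (-10 : ℤ))
            * (q ^ (15 : ℤ) - q ^ (-15 : ℤ)) =
          ((q ^ 2 - 1) * (q ^ 12 - 1) * (q ^ 20 - 1) * (q ^ 30 - 1)) / q ^ 32 := by
        simp only [_root_.zpow_neg, zpow_ofNat]
        field_simp
      rw [hr]
      congr 1
      unfold xE8P
      linear_combination -h3
    ext i j
    fin_cases i <;> fin_cases j
    · simp only [Fin.zero_eta, Fin.isValue, Matrix.smul_apply, Matrix.one_apply_eq, smul_eq_mul,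
        mul_one]
      rw [← hn, e00]; ring
    · simp [e01]
    · simp [e10]
    · simp only [Fin.mk_one, Fin.isValue, Matrix.smul_apply, Matrix.one_apply_eq, smul_eq_mul,
        mul_one]
      rw [← hn, e11]; ring
end
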